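/- Let s ≥ 3 be an integer, K ∈ (0,1/3), α ∈ (0,1), t ≥ 1, and let c > 0 be sufficiently small depending on K. Then the total energy ℰ_s[v,L](t) is equivalent to the squared norm (‖v‖_{H^s} + ‖∂L‖_{H^{s−1}})²: there exist constants c₁, c₂ > 0 depending only on s, K, c such that c₁(‖v‖_{H^s} + ‖∂L‖_{H^{s−1}})² ≤ ℰ_s[v,L](t) ≤ c₂(‖v‖_{H^s} + ‖∂L‖_{H^{s−1}})² for all v ∈ H^s(T³;ℝ³) and L ∈ H^s(T³). -/

import Mathlib

noncomputable section

open MeasureTheory Real Set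

/-- Points of the flat torus `T³`, modelled as `ℝ³` (functions are taken ℤ³-periodic). -/
abbrev Pt : Type := Fin 3 → ℝ

/-- The fundamental domain `[0,1)³` of the torus, of unit volume. -/
def cube : Set Pt := Set.univ.pi fun _ => Set.Ico (0:ℝ) 1

/-- ℤ³-periodicity: the property of descending to the torus `T³`. -/
def Periodic3 (f : Pt → ℝ) : Prop :=
  ∀ (x : Pt) (k : Fin 3 → ℤ), f (fun i => x i + (k i : ℝ)) = f x

/-- The partial derivative `∂_i f`. -/
def pd (i : Fin 3) (f : Pt → ℝ) : Pt → ℝ := fun x => fderiv ℝ f x (Pi.single i 1)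

/-- Iterated partial derivatives along a list of directions. -/
def pdIter : List (Fin 3) → (Pt → ℝ) → (Pt → ℝ)
  | [], f => f
  | i :: js, f => pd i (pdIter js f)

/-- The squared homogeneous Sobolev seminorm `‖∂^k f‖_{L²}²` on the torus. -/
def HdotSq (k : ℕ) (f : Pt → ℝ) : ℝ :=
  ∫ x in cube, ∑ js : Fin k → Fin 3, (pdIter (List.ofFn js) f x) ^ 2

/-- Squared homogeneous seminorm of a vector field. -/
def HdotSqV (k : ℕ) (v : Pt → Pt) : ℝ :=
  ∑ a : Fin 3, HdotSq k (fun x => v x a)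

/-- The homogeneous Sobolev seminorm `‖f‖_{Ḣ^k}`. -/
def Hdot (k : ℕ) (f : Pt → ℝ) : ℝ := Real.sqrt (HdotSq k f)

/-- The Sobolev norm `‖f‖_{H^s}`. -/
def HSob (s : ℕ) (f : Pt → ℝ) : ℝ :=
  Real.sqrt (∑ k ∈ Finset.range (s+1), HdotSq k f)

/-- The Sobolev norm `‖v‖_{H^s}` of a vector field. -/
def HSobV (s : ℕ) (v : Pt → Pt) : ℝ :=
  Real.sqrt (∑ k ∈ Finset.range (s+1), HdotSqV k v)

/-- The norm `‖∂f‖_{H^m}` of the full gradient of `f`. -/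
def HSobGrad (m : ℕ) (f : Pt → ℝ) : ℝ :=
  Real.sqrt (∑ k ∈ Finset.range (m+1), HdotSq (k+1) f)

/-- The mean of `f` over the torus (the fundamental cube has unit volume). -/
def mean (f : Pt → ℝ) : ℝ := ∫ x in cube, f x

/-- The (vector-valued) mean of a vector field. -/
def meanV (v : Pt → Pt) : Pt := fun a => ∫ x in cube, v x a

/-- The `L²` norm of `f` over the torus. -/
def L2norm (f : Pt → ℝ) : ℝ := Real.sqrt (∫ x in cube, (f x) ^ 2)

/-- The `L²` norm of a vector field over the torus. -/
def L2normV (v : Pt → Pt) : ℝ := Real.sqrt (∫ x in cube, ∑ a, (v x a) ^ 2)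

/-- The `L^∞` norm of `f`. -/
def LinfNorm (f : Pt → ℝ) : ℝ := ⨆ x : Pt, |f x|

/-- The `L^∞` norm `‖∂f‖_{L^∞}` of the gradient of `f`. -/
def LinfGrad (f : Pt → ℝ) : ℝ := ⨆ x : Pt, Real.sqrt (∑ i, (pd i f x) ^ 2)

/-- The `L^∞` norm `‖∂v‖_{L^∞}` of the gradient of a vector field. -/
def LinfGradV (v : Pt → Pt) : ℝ :=
  ⨆ x : Pt, Real.sqrt (∑ a, ∑ i, (pd i (fun y => v y a) x) ^ 2)

/-- The density `ρ = t^{-3α} exp L`. -/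
def rho (α t : ℝ) (L : Pt → ℝ) : Pt → ℝ := fun x => t ^ (-(3*α)) * Real.exp (L x)

/-- The mixed inner product `(∂^{ℓ-1} v, ∂^ℓ L)_{L²}`, contracting all matching
indices with the Euclidean metric (for `ℓ = 1` this is `(v, ∂L)_{L²}`). -/
def ipMixed (ℓ : ℕ) (v : Pt → Pt) (L : Pt → ℝ) : ℝ :=
  ∫ x in cube, ∑ js : Fin (ℓ-1) → Fin 3, ∑ a,
    pdIter (List.ofFn js) (fun y => v y a) x * pdIter (List.ofFn js) (pd a L) x

/-- The first-order energy `E₁[v,L](t)` with correction constant `c`. -/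
def E1 (K α c t : ℝ) (v : Pt → Pt) (L : Pt → ℝ) : ℝ :=
  (∑ a, (meanV v a) ^ 2) + HdotSqV 1 v + K * HdotSq 1 L + c * t ^ (α - 1) * ipMixed 1 v L

/-- The homogeneous energy `E_ℓ[v,L](t)` of order `ℓ > 1` with correction constant `c`. -/
def Ehigher (K α c t : ℝ) (ℓ : ℕ) (v : Pt → Pt) (L : Pt → ℝ) : ℝ :=
  HdotSqV ℓ v + K * HdotSq ℓ L + c * t ^ (α - 1) * ipMixed ℓ v L

/-- The total energy `ℰ_s[v,L] = Σ_{k=1}^s E_k[v,L]`. -/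
def Etot (K α c t : ℝ) (s : ℕ) (v : Pt → Pt) (L : Pt → ℝ) : ℝ :=
  E1 K α c t v L + ∑ k ∈ Finset.Icc 2 s, Ehigher K α c t k v L

/-- Smooth periodic solutions of the expansion-normalized Euler–Poisson system on
`[t₀,∞) × T³`:  `∂_t L = −t^{−α} v^i ∂_i L − t^{−α} ∂_i v^i`,
`∂_t v^i = −t^{−α} K δ^{ij} ∂_j L − t^{−α} v^j ∂_j v^i − α t^{−1} v^i + t^{−α} δ^{ij} ∂_j φ`,
`t^{−2α} Δφ = −(ρ − ρ̄)` with `∫ φ = 0`, where `ρ = t^{−3α} exp L`. -/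
structure IsEPSolution (α K t₀ : ℝ) (L : ℝ → Pt → ℝ) (v : ℝ → Pt → Pt)
    (φ : ℝ → Pt → ℝ) : Prop where
  smooth_L : ∀ t ∈ Ici t₀, ContDiff ℝ (⊤ : ℕ∞) (L t)
  smooth_v : ∀ t ∈ Ici t₀, ∀ a, ContDiff ℝ (⊤ : ℕ∞) (fun x => v t x a)
  smooth_φ : ∀ t ∈ Ici t₀, ContDiff ℝ (⊤ : ℕ∞) (φ t)
  periodic_L : ∀ t ∈ Ici t₀, Periodic3 (L t)
  periodic_v : ∀ t ∈ Ici t₀, ∀ a, Periodic3 (fun x => v t x a)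
  periodic_φ : ∀ t ∈ Ici t₀, Periodic3 (φ t)
  eq_L : ∀ t ∈ Ici t₀, ∀ x, HasDerivWithinAt (fun τ => L τ x)
      (-(t ^ (-α)) * (∑ i, v t x i * pd i (L t) x)
        - t ^ (-α) * (∑ i, pd i (fun y => v t y i) x)) (Ici t₀) t
  eq_v : ∀ t ∈ Ici t₀, ∀ x, ∀ i, HasDerivWithinAt (fun τ => v τ x i)
      (-(t ^ (-α)) * K * pd i (L t) x
        - t ^ (-α) * (∑ j, v t x j * pd j (fun y => v t y i) x)
        - α * t⁻¹ * v t x i + t ^ (-α) * pd i (φ t) x) (Ici t₀) t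
  eq_φ : ∀ t ∈ Ici t₀, ∀ x,
      t ^ (-(2*α)) * (∑ i, pd i (pd i (φ t)) x)
        = -(rho α t (L t) x - mean (rho α t (L t)))
  mean_φ : ∀ t ∈ Ici t₀, mean (φ t) = 0

/-- The uniform probability measure on the unit interval. -/
abbrev unitMeasure : Measure ℝ := volume.restrict (Ico (0:ℝ) 1)

instance : IsProbabilityMeasure unitMeasure := ⟨by simp [unitMeasure]⟩

/-- The uniform probability measure on the unit cube. -/
abbrev cubeMeasure : Measure Pt := Measure.pi fun _ => unitMeasure

lemma volume_restrict_cube : (volume : Measure Pt).restrict cube = cubeMeasure := by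
  rw [cube, volume_pi, Measure.restrict_pi_pi]

lemma integrable_unitMeasure {g : ℝ → ℝ} (hg : Continuous g) : Integrable g unitMeasure :=
  (hg.integrableOn_Icc (a := 0) (b := 1)).mono_set Ico_subset_Icc_self

lemma integrable_cubeMeasure {f : Pt → ℝ} (hf : Continuous f) : Integrable f cubeMeasure := by
  rw [← volume_restrict_cube]
  refine (hf.continuousOn.integrableOn_compact
    (isCompact_univ_pi fun _ : Fin 3 => isCompact_Icc (a := (0:ℝ)) (b := 1))).mono_set ?_
  exact Set.pi_mono fun _ _ => Ico_subset_Icc_self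

lemma sq_integral_le {Ω : Type*} [MeasurableSpace Ω] (μ : Measure Ω) [IsProbabilityMeasure μ]
    {h : Ω → ℝ} (h1 : Integrable h μ) (h2 : Integrable (fun x => h x ^ 2) μ) :
    (∫ x, h x ∂μ) ^ 2 ≤ ∫ x, h x ^ 2 ∂μ := by
  set m := ∫ x, h x ∂μ with hm
  have h0 : 0 ≤ ∫ x, (h x ^ 2 - 2 * m * h x + m ^ 2) ∂μ :=
    integral_nonneg fun x => by
      show 0 ≤ h x ^ 2 - 2 * m * h x + m ^ 2
      nlinarith [sq_nonneg (h x - m)]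
  rw [integral_add (f := fun x => h x ^ 2 - 2 * m * h x) (h2.sub (h1.const_mul _))
    (integrable_const _), integral_sub h2 (h1.const_mul _), integral_const_mul, ← hm] at h0
  simp at h0
  nlinarith

lemma sq_sub_le_integral_sq_deriv {g g' : ℝ → ℝ} (hg : ∀ x, HasDerivAt g (g' x) x)
    (hc : Continuous g') {a b : ℝ} (ha : a ∈ Ico (0:ℝ) 1) (hb : b ∈ Ico (0:ℝ) 1) :
    (g b - g a) ^ 2 ≤ ∫ s, g' s ^ 2 ∂unitMeasure := by
  have h1 : |g b - g a| ≤ ∫ s, |g' s| ∂unitMeasure := by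
    rw [← intervalIntegral.integral_eq_sub_of_hasDerivAt (fun x _ => hg x)
      (hc.intervalIntegrable a b)]
    refine (intervalIntegral.norm_integral_le_integral_norm_uIoc (f := g')).trans ?_
    refine setIntegral_mono_set (integrable_unitMeasure hc.abs)
      (Filter.Eventually.of_forall fun x => abs_nonneg _) (LE.le.eventuallyLE ?_)
    intro x hx
    rw [mem_uIoc] at hx
    simp only [mem_Ico] at ha hb ⊢
    rcases hx with hx | hx <;> constructor <;> linarith
  have h2 := sq_integral_le unitMeasure (integrable_unitMeasure hc.abs)
    (integrable_unitMeasure (hc.abs.fun_pow 2))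
  simp only [sq_abs] at h2
  calc (g b - g a) ^ 2 = |g b - g a| ^ 2 := (sq_abs _).symm
    _ ≤ _ := pow_le_pow_left₀ (abs_nonneg _) h1 2
    _ ≤ _ := h2

/-- The point with the coordinates of `x` where `p` holds and those of `y` elsewhere. -/
def mixPt (p : Fin 3 → Prop) [DecidablePred p] (z : Pt × Pt) : Pt :=
  fun i => if p i then z.1 i else z.2 i

lemma measurePreserving_mixPt (p : Fin 3 → Prop) [DecidablePred p] :
    MeasurePreserving (mixPt p) (cubeMeasure.prod cubeMeasure) cubeMeasure := by
  have hm : Measurable (mixPt p) := by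
    refine measurable_pi_lambda _ fun i => ?_
    unfold mixPt
    by_cases h : p i
    · simp only [h, if_true]; fun_prop
    · simp only [h, if_false]; fun_prop
  refine ⟨hm, (Measure.pi_eq fun s hs => ?_).symm⟩
  rw [Measure.map_apply hm (MeasurableSet.univ_pi hs)]
  have hpre : mixPt p ⁻¹' (univ.pi s) =
      (univ.pi fun i => if p i then s i else univ) ×ˢ
        (univ.pi fun i => if p i then univ else s i) := by
    ext z
    simp only [mixPt, mem_preimage, mem_pi, mem_univ, true_imp_iff, mem_prod, ← forall_and]
    refine forall_congr' fun i => ?_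
    by_cases h : p i <;> simp [h]
  rw [hpre, Measure.prod_prod, Measure.pi_pi, Measure.pi_pi, ← Finset.prod_mul_distrib]
  refine Finset.prod_congr rfl fun i _ => ?_
  by_cases h : p i <;> simp [h]

lemma contDiff_pd {f : Pt → ℝ} (hf : ContDiff ℝ (⊤ : ℕ∞) f) (i : Fin 3) :
    ContDiff ℝ (⊤ : ℕ∞) (pd i f) :=
  (hf.fderiv_right (m := (⊤ : ℕ∞)) (by norm_cast)).clm_apply contDiff_const

lemma contDiff_pdIter {f : Pt → ℝ} (hf : ContDiff ℝ (⊤ : ℕ∞) f) (l : List (Fin 3)) :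
    ContDiff ℝ (⊤ : ℕ∞) (pdIter l f) := by
  induction l with
  | nil => exact hf
  | cons i l ih => exact contDiff_pd ih i

lemma pdIter_append_singleton (l : List (Fin 3)) (a : Fin 3) (f : Pt → ℝ) :
    pdIter (l ++ [a]) f = pdIter l (pd a f) := by
  induction l with
  | nil => rfl
  | cons i l ih => simp [pdIter, ih]

/-- The mean of `|∂_k f|²` over the line through `z` in direction `k`. -/
def lineMean (f : Pt → ℝ) (k : Fin 3) (z : Pt) : ℝ :=
  ∫ y, pd k f (mixPt (· = k) (y, z)) ^ 2 ∂cubeMeasure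

lemma sq_sub_update_le_lineMean {f : Pt → ℝ} (hf : ContDiff ℝ (⊤ : ℕ∞) f) (k : Fin 3)
    {z : Pt} {r : ℝ} (hz : z k ∈ Ico (0:ℝ) 1) (hr : r ∈ Ico (0:ℝ) 1) :
    (f z - f (Function.update z k r)) ^ 2 ≤ lineMean f k z := by
  have hu : Continuous fun s : ℝ => Function.update z k s := continuous_const.update k continuous_id
  have hd : ∀ s, HasDerivAt (fun s => f (Function.update z k s))
      (pd k f (Function.update z k s)) s := fun s =>
    ((hf.differentiable (by simp) _).hasFDerivAt).comp_hasDerivAt s (hasDerivAt_update z k s)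
  have hc : Continuous fun s => pd k f (Function.update z k s) :=
    (contDiff_pd hf k).continuous.comp hu
  have h := sq_sub_le_integral_sq_deriv hd hc hr hz
  rw [Function.update_eq_self] at h
  refine h.trans_eq ?_
  have he : MeasurePreserving (Function.eval k) cubeMeasure unitMeasure :=
    measurePreserving_eval (fun _ : Fin 3 => unitMeasure) k
  rw [← he.map_eq, integral_map he.measurable.aemeasurable
    (hc.fun_pow 2).aestronglyMeasurable]
  unfold lineMean
  congr 1
  ext y
  congr 2
  ext i
  by_cases hi : i = k
  · subst hi; simp [mixPt]
  · simp [mixPt, hi]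

lemma integrable_sq_pd_mixPt {f : Pt → ℝ} (hf : ContDiff ℝ (⊤ : ℕ∞) f) (k : Fin 3) :
    Integrable (fun w => pd k f (mixPt (· = k) w) ^ 2) (cubeMeasure.prod cubeMeasure) :=
  (measurePreserving_mixPt _).integrable_comp_of_integrable
    (integrable_cubeMeasure ((contDiff_pd hf k).continuous.fun_pow 2))

lemma integrable_lineMean {f : Pt → ℝ} (hf : ContDiff ℝ (⊤ : ℕ∞) f) (k : Fin 3) :
    Integrable (lineMean f k) cubeMeasure :=
  (integrable_sq_pd_mixPt hf k).integral_prod_right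

lemma integral_comp_mixPt (p : Fin 3 → Prop) [DecidablePred p] {F : Pt → ℝ}
    (hF : Integrable F cubeMeasure) :
    ∫ w, F (mixPt p w) ∂(cubeMeasure.prod cubeMeasure) = ∫ x, F x ∂cubeMeasure := by
  have h := measurePreserving_mixPt p
  conv_rhs => rw [← h.map_eq]
  rw [integral_map h.measurable.aemeasurable (by rw [h.map_eq]; exact hF.aestronglyMeasurable)]

lemma integral_lineMean {f : Pt → ℝ} (hf : ContDiff ℝ (⊤ : ℕ∞) f) (k : Fin 3) :
    ∫ z, lineMean f k z ∂cubeMeasure = ∫ x, pd k f x ^ 2 ∂cubeMeasure := by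
  rw [← integral_comp_mixPt (· = k)
    (integrable_cubeMeasure ((contDiff_pd hf k).continuous.fun_pow 2))]
  exact (integral_prod_symm _ (integrable_sq_pd_mixPt hf k)).symm

lemma sq_sub_le_sum_lineMean {f : Pt → ℝ} (hf : ContDiff ℝ (⊤ : ℕ∞) f) {w : Pt × Pt}
    (h1 : w.1 ∈ cube) (h2 : w.2 ∈ cube) :
    (f w.1 - f w.2) ^ 2 ≤ 3 * ∑ k : Fin 3, lineMean f k (mixPt (k ≤ ·) w) := by
  have step : ∀ k : Fin 3, (f (mixPt (k ≤ ·) w) -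
      f (Function.update (mixPt (k ≤ ·) w) k (w.2 k))) ^ 2 ≤ lineMean f k (mixPt (k ≤ ·) w) :=
    fun k => sq_sub_update_le_lineMean hf k
      (by simpa [mixPt] using h1 k (mem_univ k)) (h2 k (mem_univ k))
  have e0 : mixPt ((0 : Fin 3) ≤ ·) w = w.1 := by ext i; simp [mixPt]
  have e1 : Function.update (mixPt ((0 : Fin 3) ≤ ·) w) 0 (w.2 0) = mixPt ((1 : Fin 3) ≤ ·) w := by
    ext i; fin_cases i <;> simp [mixPt]
  have e2 : Function.update (mixPt ((1 : Fin 3) ≤ ·) w) 1 (w.2 1) = mixPt ((2 : Fin 3) ≤ ·) w := by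
    ext i; fin_cases i <;> simp [mixPt]
  have e3 : Function.update (mixPt ((2 : Fin 3) ≤ ·) w) 2 (w.2 2) = w.2 := by
    ext i; fin_cases i <;> simp [mixPt]
  have s0 := step 0
  have s1 := step 1
  have s2 := step 2
  rw [e1] at s0
  rw [e2] at s1
  rw [e3] at s2
  rw [Fin.sum_univ_three]
  nth_rewrite 1 [e0] at s0
  set A := f (mixPt ((1 : Fin 3) ≤ ·) w)
  set B := f (mixPt ((2 : Fin 3) ≤ ·) w)
  nlinarith [sq_nonneg ((f w.1 - A) - (A - B)), sq_nonneg ((f w.1 - A) - (B - f w.2)),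
    sq_nonneg ((A - B) - (B - f w.2))]

/-- Poincaré inequality on the unit cube. -/
lemma poincare_cube {f : Pt → ℝ} (hf : ContDiff ℝ (⊤ : ℕ∞) f) :
    ∫ x, f x ^ 2 ∂cubeMeasure ≤
      (∫ x, f x ∂cubeMeasure) ^ 2 + 3 / 2 * ∑ k, ∫ x, pd k f x ^ 2 ∂cubeMeasure := by
  have i1 := integrable_cubeMeasure hf.continuous
  have i2 := integrable_cubeMeasure (hf.continuous.fun_pow 2)
  have j1 : Integrable (fun w : Pt × Pt => f w.1 ^ 2) (cubeMeasure.prod cubeMeasure) :=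
    i2.comp_fst cubeMeasure
  have j2 : Integrable (fun w : Pt × Pt => f w.2 ^ 2) (cubeMeasure.prod cubeMeasure) :=
    i2.comp_snd cubeMeasure
  have j3 : Integrable (fun w : Pt × Pt => f w.1 * f w.2) (cubeMeasure.prod cubeMeasure) :=
    i1.mul_prod i1
  have key : ∫ w : Pt × Pt, (f w.1 - f w.2) ^ 2 ∂(cubeMeasure.prod cubeMeasure) =
      2 * ∫ x, f x ^ 2 ∂cubeMeasure - 2 * (∫ x, f x ∂cubeMeasure) ^ 2 := by
    have : (fun w : Pt × Pt => (f w.1 - f w.2) ^ 2) =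
        fun w => f w.1 ^ 2 + f w.2 ^ 2 - 2 * (f w.1 * f w.2) := by ext w; ring
    rw [this, integral_sub (f := fun w => f w.1 ^ 2 + f w.2 ^ 2) (j1.add j2)
      (j3.const_mul 2), integral_add j1 j2, integral_const_mul,
      integral_prod_mul f f, integral_fun_fst (fun x => f x ^ 2),
      integral_fun_snd (fun x => f x ^ 2)]
    simp
    ring
  have hL : ∀ k : Fin 3, Integrable (fun w => lineMean f k (mixPt (k ≤ ·) w))
      (cubeMeasure.prod cubeMeasure) := fun k =>
    (measurePreserving_mixPt _).integrable_comp_of_integrable (integrable_lineMean hf k)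
  have hcube : ∀ᵐ x ∂cubeMeasure, x ∈ cube := by
    rw [← volume_restrict_cube]
    exact ae_restrict_mem (MeasurableSet.univ_pi fun _ => measurableSet_Ico)
  have bound : ∫ w : Pt × Pt, (f w.1 - f w.2) ^ 2 ∂(cubeMeasure.prod cubeMeasure) ≤
      ∫ w, 3 * ∑ k : Fin 3, lineMean f k (mixPt (k ≤ ·) w) ∂(cubeMeasure.prod cubeMeasure) := by
    refine integral_mono_of_nonneg (Filter.Eventually.of_forall fun w => sq_nonneg _)
      ((integrable_finsetSum _ fun k _ => hL k).const_mul 3) ?_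
    filter_upwards [Measure.quasiMeasurePreserving_fst.ae hcube,
      Measure.quasiMeasurePreserving_snd.ae hcube] with w h1 h2
    exact sq_sub_le_sum_lineMean hf h1 h2
  rw [integral_const_mul, integral_finsetSum _ fun k _ => hL k, key] at bound
  simp only [integral_comp_mixPt _ (integrable_lineMean hf _), integral_lineMean hf] at bound
  linarith

lemma HdotSq_zero (f : Pt → ℝ) : HdotSq 0 f = ∫ x, f x ^ 2 ∂cubeMeasure := by
  rw [← volume_restrict_cube]
  simp [HdotSq, pdIter]

lemma HdotSq_one {f : Pt → ℝ} (hf : ContDiff ℝ (⊤ : ℕ∞) f) :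
    HdotSq 1 f = ∑ k, ∫ x, pd k f x ^ 2 ∂cubeMeasure := by
  rw [← integral_finsetSum _ fun k _ =>
    integrable_cubeMeasure ((contDiff_pd hf k).continuous.fun_pow 2), ← volume_restrict_cube]
  unfold HdotSq
  refine integral_congr_ae (Filter.Eventually.of_forall fun x => ?_)
  exact Fintype.sum_equiv (Equiv.funUnique (Fin 1) (Fin 3)) _ _
    fun js => by simp [pdIter]

lemma HdotSq_nonneg (k : ℕ) (f : Pt → ℝ) : 0 ≤ HdotSq k f :=
  integral_nonneg fun _ => Finset.sum_nonneg fun _ _ => sq_nonneg _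

lemma HdotSqV_nonneg (k : ℕ) (v : Pt → Pt) : 0 ≤ HdotSqV k v :=
  Finset.sum_nonneg fun _ _ => HdotSq_nonneg _ _

lemma HdotSq_succ (k : ℕ) (f : Pt → ℝ) :
    HdotSq (k + 1) f =
      ∫ x in cube, ∑ js : Fin k → Fin 3, ∑ a, pdIter (List.ofFn js) (pd a f) x ^ 2 := by
  unfold HdotSq
  congr 1
  ext x
  rw [← (Fin.snocEquiv fun _ => Fin 3).sum_comp, Fintype.sum_prod_type_right]
  refine Finset.sum_congr rfl fun js _ => Finset.sum_congr rfl fun a _ => ?_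
  rw [← pdIter_append_singleton, List.ofFn_succ']
  simp [Fin.snocEquiv]

lemma abs_ipMixed_le {v : Pt → Pt} {L : Pt → ℝ}
    (hv : ∀ a, ContDiff ℝ (⊤ : ℕ∞) fun x => v x a) (hL : ContDiff ℝ (⊤ : ℕ∞) L) (k : ℕ) :
    |ipMixed (k + 1) v L| ≤ 1 / 2 * (HdotSqV k v + HdotSq (k + 1) L) := by
  have cv : ∀ (js : Fin k → Fin 3) a,
      Continuous (pdIter (List.ofFn js) fun y => v y a) :=
    fun js a => (contDiff_pdIter (hv a) _).continuous
  have cL : ∀ (js : Fin k → Fin 3) a, Continuous (pdIter (List.ofFn js) (pd a L)) :=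
    fun js a => (contDiff_pdIter (contDiff_pd hL a) _).continuous
  have hV : HdotSqV k v =
      ∫ x, ∑ js : Fin k → Fin 3, ∑ a, pdIter (List.ofFn js) (fun y => v y a) x ^ 2
        ∂cubeMeasure := by
    unfold HdotSqV HdotSq
    rw [volume_restrict_cube, ← integral_finsetSum _ fun a _ => integrable_cubeMeasure
      (continuous_finsetSum _ fun js _ => (cv js a).fun_pow 2)]
    congr 1
    ext x
    exact Finset.sum_comm
  rw [hV, HdotSq_succ, ipMixed, volume_restrict_cube, ← integral_add
    (integrable_cubeMeasure (by fun_prop)) (integrable_cubeMeasure (by fun_prop)),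
    ← integral_const_mul, ← Real.norm_eq_abs]
  refine norm_integral_le_of_norm_le (integrable_cubeMeasure (by fun_prop))
    (Filter.Eventually.of_forall fun x => ?_)
  change ‖∑ js : Fin k → Fin 3, ∑ a, pdIter (List.ofFn js) (fun y => v y a) x *
    pdIter (List.ofFn js) (pd a L) x‖ ≤ _
  rw [← Finset.sum_add_distrib, Finset.mul_sum]
  refine norm_sum_le_of_le _ fun js _ => ?_
  rw [← Finset.sum_add_distrib, Finset.mul_sum]
  refine norm_sum_le_of_le _ fun a _ => ?_
  rw [Real.norm_eq_abs, abs_le]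
  set p := pdIter (List.ofFn js) (fun y => v y a) x
  set q := pdIter (List.ofFn js) (pd a L) x
  constructor <;> nlinarith [sq_nonneg (p - q), sq_nonneg (p + q)]

lemma sum_sq_meanV_le {v : Pt → Pt} (hv : ∀ a, ContDiff ℝ (⊤ : ℕ∞) fun x => v x a) :
    ∑ a, meanV v a ^ 2 ≤ HdotSqV 0 v :=
  Finset.sum_le_sum fun a _ => by
    rw [HdotSq_zero, meanV, volume_restrict_cube]
    exact sq_integral_le cubeMeasure (integrable_cubeMeasure (hv a).continuous)
      (integrable_cubeMeasure ((hv a).continuous.fun_pow 2))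

lemma HdotSqV_zero_le {v : Pt → Pt} (hv : ∀ a, ContDiff ℝ (⊤ : ℕ∞) fun x => v x a) :
    HdotSqV 0 v ≤ ∑ a, meanV v a ^ 2 + 3 / 2 * HdotSqV 1 v := by
  unfold HdotSqV
  rw [Finset.mul_sum, ← Finset.sum_add_distrib]
  refine Finset.sum_le_sum fun a _ => ?_
  rw [HdotSq_zero, HdotSq_one (hv a), meanV, volume_restrict_cube]
  exact poincare_cube (hv a)

lemma Etot_eq (K α c t : ℝ) (n : ℕ) (v : Pt → Pt) (L : Pt → ℝ) :
    Etot K α c t (n + 1) v L = ∑ a, meanV v a ^ 2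
      + ∑ k ∈ Finset.range (n + 1), HdotSqV (k + 1) v
      + K * ∑ k ∈ Finset.range (n + 1), HdotSq (k + 1) L
      + c * t ^ (α - 1) * ∑ k ∈ Finset.range (n + 1), ipMixed (k + 1) v L := by
  induction n with
  | zero => simp [Etot, E1]
  | succ n ih =>
    have h : Etot K α c t (n + 1 + 1) v L =
        Etot K α c t (n + 1) v L + Ehigher K α c t (n + 1 + 1) v L := by
      rw [Etot, Etot, Finset.sum_Icc_succ_top (by omega), ← add_assoc]
    rw [h, ih, Finset.sum_range_succ _ (n + 1), Finset.sum_range_succ _ (n + 1),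
      Finset.sum_range_succ _ (n + 1), Ehigher]
    ring

lemma energy_bounds {K c τ M V₀ A B I x y : ℝ} (hK0 : 0 < K) (hK1 : K < 1 / 3) (hc : 0 < c)
    (hcK : c < K) (hτ0 : 0 ≤ τ) (hτ1 : τ ≤ 1) (hM0 : 0 ≤ M) (hV0 : 0 ≤ V₀) (hA1 : 0 ≤ A)
    (hB0 : 0 ≤ B) (hMV : M ≤ V₀) (hVM : V₀ ≤ M + 3 / 2 * A)
    (hI : |I| ≤ 1 / 2 * (V₀ + A + B)) (hx0 : 0 ≤ x) (hy0 : 0 ≤ y) (hx : x ^ 2 = A + V₀)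
    (hy : y ^ 2 = B) :
    K / 10 * (x + y) ^ 2 ≤ M + A + K * B + c * τ * I ∧
      M + A + K * B + c * τ * I ≤ 2 * (x + y) ^ 2 := by
  have hcI : |c * τ * I| ≤ K * (1 / 2 * (V₀ + A + B)) := by
    rw [abs_mul, abs_of_nonneg (by positivity)]
    refine mul_le_mul ?_ hI (abs_nonneg _) hK0.le
    nlinarith
  obtain ⟨h1, h2⟩ := abs_le.1 hcI
  have hKV : K * V₀ ≤ K * (M + 3 / 2 * A) := mul_le_mul_of_nonneg_left (by linarith) hK0.le
  have hKM : K * M ≤ 1 / 3 * M := mul_le_mul_of_nonneg_right hK1.le hM0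
  have hKA : K * A ≤ 1 / 3 * A := mul_le_mul_of_nonneg_right hK1.le hA1
  have hKB : K * B ≤ 1 / 3 * B := mul_le_mul_of_nonneg_right hK1.le hB0
  have hKV' : K * V₀ ≤ 1 / 3 * V₀ := mul_le_mul_of_nonneg_right hK1.le hV0
  have hxy := sq_nonneg (x - y)
  have hxy0 := mul_nonneg hx0 hy0
  rw [sub_sq] at hxy
  rw [add_sq]
  constructor
  · have hsq : x ^ 2 + 2 * x * y + y ^ 2 ≤ 2 * (V₀ + A + B) := by linarith
    have := mul_le_mul_of_nonneg_left hsq (show 0 ≤ K / 10 by positivity)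
    have hKB0 : 0 ≤ K * B := by positivity
    have hKA0 : 0 ≤ K * A := by positivity
    have hKM0 : 0 ≤ K * M := by positivity
    linarith
  · have hsq : V₀ + A + B ≤ x ^ 2 + 2 * x * y + y ^ 2 := by linarith
    linarith

/-- coercivity of the energy: for `s ≥ 3`, `K ∈ (0,1/3)`, `α ∈ (0,1)`
and `c > 0` sufficiently small depending on `K`, there are `c₁, c₂ > 0` depending only
on `s, K, c` with `c₁(‖v‖_{H^s} + ‖∂L‖_{H^{s−1}})² ≤ ℰ_s[v,L](t) ≤
c₂(‖v‖_{H^s} + ‖∂L‖_{H^{s−1}})²` for all `t ≥ 1`, `v ∈ H^s(T³;ℝ³)`, `L ∈ H^s(T³)`. -/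
theorem statement2 (s : ℕ) (hs : 3 ≤ s) (K α : ℝ)
    (hK : K ∈ Set.Ioo (0:ℝ) (1/3)) (hα : α ∈ Set.Ioo (0:ℝ) 1) :
    ∃ c₀ > 0, ∀ c : ℝ, 0 < c → c < c₀ →
      ∃ c₁ > 0, ∃ c₂ > 0, ∀ t : ℝ, 1 ≤ t →
        ∀ (v : Pt → Pt) (L : Pt → ℝ),
          (∀ a, ContDiff ℝ (⊤ : ℕ∞) fun x => v x a) → ContDiff ℝ (⊤ : ℕ∞) L →
          (∀ a, Periodic3 fun x => v x a) → Periodic3 L →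
          c₁ * (HSobV s v + HSobGrad (s-1) L) ^ 2 ≤ Etot K α c t s v L ∧
          Etot K α c t s v L ≤ c₂ * (HSobV s v + HSobGrad (s-1) L) ^ 2 := by
  obtain ⟨n, rfl⟩ : ∃ n, s = n + 1 := ⟨s - 1, by omega⟩
  obtain ⟨hK0, hK1⟩ := hK
  refine ⟨K, hK0, fun c hc hcK => ⟨K / 10, by positivity, 2, two_pos, ?_⟩⟩
  intro t ht v L hv hL _ _
  have hM0 : 0 ≤ ∑ a, meanV v a ^ 2 := Finset.sum_nonneg fun a _ => sq_nonneg _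
  have hMV := sum_sq_meanV_le hv
  have hVM := HdotSqV_zero_le hv
  have hA : HdotSqV 1 v ≤ ∑ k ∈ Finset.range (n + 1), HdotSqV (k + 1) v :=
    Finset.single_le_sum (f := fun k => HdotSqV (k + 1) v)
      (fun k _ => HdotSqV_nonneg _ _) (Finset.mem_range.2 n.succ_pos)
  have hA0 := HdotSqV_nonneg 1 v
  have hV0 := HdotSqV_nonneg 0 v
  have hB0 : 0 ≤ ∑ k ∈ Finset.range (n + 1), HdotSq (k + 1) L :=
    Finset.sum_nonneg fun k _ => HdotSq_nonneg _ _
  have hI : |∑ k ∈ Finset.range (n + 1), ipMixed (k + 1) v L| ≤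
      1 / 2 * (HdotSqV 0 v + ∑ k ∈ Finset.range (n + 1), HdotSqV (k + 1) v
        + ∑ k ∈ Finset.range (n + 1), HdotSq (k + 1) L) := by
    refine (Finset.abs_sum_le_sum_abs _ _).trans
      ((Finset.sum_le_sum fun k _ => abs_ipMixed_le hv hL k).trans ?_)
    rw [← Finset.mul_sum, Finset.sum_add_distrib, Finset.sum_range_succ' (fun k => HdotSqV k v),
      Finset.sum_range_succ (fun k => HdotSqV (k + 1) v)]
    linarith [HdotSqV_nonneg (n + 1) v]
  have hτ0 : 0 ≤ t ^ (α - 1) := Real.rpow_nonneg (by linarith) _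
  have hτ1 : t ^ (α - 1) ≤ 1 := Real.rpow_le_one_of_one_le_of_nonpos ht (by linarith [hα.2])
  rw [Etot_eq]
  have hx : HSobV (n + 1) v ^ 2 = ∑ k ∈ Finset.range (n + 1), HdotSqV (k + 1) v + HdotSqV 0 v := by
    rw [HSobV, Real.sq_sqrt (Finset.sum_nonneg fun k _ => HdotSqV_nonneg _ _),
      Finset.sum_range_succ']
  have hy : HSobGrad (n + 1 - 1) L ^ 2 = ∑ k ∈ Finset.range (n + 1), HdotSq (k + 1) L := by
    rw [HSobGrad, Nat.add_sub_cancel, Real.sq_sqrt hB0]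
  have hx0 : 0 ≤ HSobV (n + 1) v := Real.sqrt_nonneg _
  have hy0 : 0 ≤ HSobGrad (n + 1 - 1) L := Real.sqrt_nonneg _
  exact energy_bounds hK0 hK1 hc hcK hτ0 hτ1 hM0 hV0 (hA0.trans hA) hB0 hMV
    (by linarith) hI hx0 hy0 hx hy
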